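/- arXiv:1612.04219 — 2 statements merged into one kernel-verified Lean document; each statement's English description precedes it below -/
import Mathlib

section
/- Let u, v ∈ Σ⁺ be words with the same content. If every semigroup homomorphism φ : Σ⁺ → UT_n(𝔽𝕋) with φ(s)_{n,n} = 0 for all s ∈ Σ satisfies φ(u) = φ(v), then the identity u = v holds in UT_n(𝕋). -/
/-- The tropical (max-plus) semiring `𝕋 = ℝ ∪ {-∞}`, with `⊕ = max` and `⊗ = +`. -/
abbrev TT : Type := WithBot ℝ

/-- Tropical (max-plus) multiplication of square matrices over `𝕋`:
`(A ⊗ B) i j = max_k (A i k + B k j)`. -/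
def tmul {ι : Type} [Fintype ι] (A B : Matrix ι ι TT) : Matrix ι ι TT :=
  fun i j => Finset.univ.sup fun k => A i k + B k j

/-- The image of a word under the semigroup homomorphism from the free semigroup `Σ⁺`
to tropical matrices determined by the letter assignment `a` (junk value on the empty word). -/
def evalWord {ι σ : Type} [Fintype ι] (a : σ → Matrix ι ι TT) : List σ → Matrix ι ι TT
  | [] => fun _ _ => ⊥
  | h :: t => t.foldl (fun M s => tmul M (a s)) (a h)

/-- A tropical matrix is upper triangular if all entries strictly below the diagonal are `-∞`. -/
def IsUT {n : ℕ} (A : Matrix (Fin n) (Fin n) TT) : Prop :=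
  ∀ i j : Fin n, j < i → A i j = ⊥

/-- `f` approximates `x` from above as `t → ∞`, up to an error decaying linearly to `-∞`. -/
def TropApprox (f : ℝ → TT) (x : TT) : Prop :=
  ∃ K : ℝ, ∀ t : ℝ, 0 ≤ t → x ≤ f t ∧ f t ≤ max x ((K - t : ℝ) : TT)

theorem TropApprox.sup {ι : Type} (s : Finset ι) {f : ι → ℝ → TT} {x : ι → TT}
    (hf : ∀ k, TropApprox (f k) (x k)) :
    TropApprox (fun t => s.sup fun k => f k t) (s.sup x) := by
  choose K hK using hf
  obtain ⟨L, hL⟩ := (s.image K).bddAbove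
  refine ⟨L, fun t ht => ⟨Finset.sup_mono_fun fun k _ => (hK k t ht).1, ?_⟩⟩
  refine Finset.sup_le fun k hk => (hK k t ht).2.trans ?_
  refine max_le_max (Finset.le_sup hk) ?_
  have : K k ≤ L := hL (Finset.mem_coe.2 (Finset.mem_image_of_mem K hk))
  exact WithBot.coe_le_coe.2 (by linarith)

theorem TropApprox.add {f g : ℝ → TT} {x y : TT} (hf : TropApprox f x) (hg : TropApprox g y) :
    TropApprox (fun t => f t + g t) (x + y) := by
  obtain ⟨K, hK⟩ := hf
  obtain ⟨L, hL⟩ := hg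
  have aux : ∃ N : ℝ, K + L ≤ N ∧ (∀ r : ℝ, x = r → r + L ≤ N) ∧
      (∀ r : ℝ, y = r → K + r ≤ N) := by
    have bound : ∀ (z : TT) (c : ℝ), ∃ N : ℝ, ∀ r : ℝ, z = r → r + c ≤ N := by
      intro z c
      induction z using WithBot.recBotCoe with
      | bot => exact ⟨0, fun r hr => absurd hr WithBot.bot_ne_coe⟩
      | coe q => exact ⟨q + c, fun r hr => by rw [WithBot.coe_inj.1 hr]⟩
    obtain ⟨N₁, h₁⟩ := bound x L
    obtain ⟨N₂, h₂⟩ := bound y K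
    refine ⟨max (K + L) (max N₁ N₂), le_max_left _ _, fun r hr => ?_, fun r hr => ?_⟩
    · exact (h₁ r hr).trans ((le_max_left _ _).trans (le_max_right _ _))
    · rw [add_comm]
      exact (h₂ r hr).trans ((le_max_right _ _).trans (le_max_right _ _))
  obtain ⟨N, hN, hx, hy⟩ := aux
  refine ⟨N, fun t ht => ⟨add_le_add (hK t ht).1 (hL t ht).1, ?_⟩⟩
  refine (add_le_add (hK t ht).2 (hL t ht).2).trans ?_
  rcases max_choice x ((K - t : ℝ) : TT) with e₁ | e₁ <;>
    rcases max_choice y ((L - t : ℝ) : TT) with e₂ | e₂ <;> rw [e₁, e₂]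
  · exact le_max_left _ _
  · refine le_max_of_le_right ?_
    induction x using WithBot.recBotCoe with
    | bot => simp
    | coe r =>
      rw [← WithBot.coe_add, WithBot.coe_le_coe]
      linarith [hx r rfl]
  · refine le_max_of_le_right ?_
    induction y using WithBot.recBotCoe with
    | bot => simp
    | coe r =>
      rw [← WithBot.coe_add, WithBot.coe_le_coe]
      linarith [hy r rfl]
  · refine le_max_of_le_right ?_
    rw [← WithBot.coe_add, WithBot.coe_le_coe]
    linarith

theorem TropApprox.le {f : ℝ → TT} {x y : TT} (hx : TropApprox f x) (hy : TropApprox f y) :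
    x ≤ y := by
  obtain ⟨K, hK⟩ := hx
  obtain ⟨L, hL⟩ := hy
  induction x using WithBot.recBotCoe with
  | bot => exact bot_le
  | coe r =>
    have ht : 0 ≤ |L - r| + 1 := by positivity
    refine (le_max_iff.1 ((hK _ ht).1.trans (hL _ ht).2)).resolve_right fun h => ?_
    have := WithBot.coe_le_coe.1 h
    linarith [le_abs_self (L - r)]

theorem TropApprox.foldl_tmul {ι σ : Type} [Fintype ι] {a : σ → Matrix ι ι TT}
    {b : ℝ → σ → Matrix ι ι TT} (hb : ∀ s i j, TropApprox (fun t => b t s i j) (a s i j))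
    (w : List σ) {M : Matrix ι ι TT} {N : ℝ → Matrix ι ι TT}
    (hN : ∀ i j, TropApprox (fun t => N t i j) (M i j)) (i j : ι) :
    TropApprox (fun t => w.foldl (fun A s => tmul A (b t s)) (N t) i j)
      (w.foldl (fun A s => tmul A (a s)) M i j) := by
  induction w generalizing M N with
  | nil => exact hN i j
  | cons s w ih =>
    exact ih fun i j => TropApprox.sup _ fun k => (hN i k).add (hb s k j)

theorem TropApprox.evalWord {ι σ : Type} [Fintype ι] {a : σ → Matrix ι ι TT}
    {b : ℝ → σ → Matrix ι ι TT} (hb : ∀ s i j, TropApprox (fun t => b t s i j) (a s i j))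
    (w : List σ) (i j : ι) :
    TropApprox (fun t => evalWord (b t) w i j) (evalWord a w i j) := by
  cases w with
  | nil => exact ⟨0, fun _ _ => ⟨bot_le, bot_le⟩⟩
  | cons s w => exact TropApprox.foldl_tmul hb w (hb s) i j

/-- The tropical scalar multiple of a matrix by a finite scalar. -/
def tropShift {ι : Type} (c : ℝ) (A : Matrix ι ι TT) : Matrix ι ι TT :=
  fun i j => A i j + (c : TT)

theorem tropShift_injective {ι : Type} (c : ℝ) :
    Function.Injective (tropShift (ι := ι) c) := by
  intro A B h
  ext1 i j
  exact WithBot.add_right_cancel WithBot.coe_ne_bot (congrFun (congrFun h i) j)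

theorem tmul_tropShift {ι : Type} [Fintype ι] (c d : ℝ) (A B : Matrix ι ι TT) :
    tmul (tropShift c A) (tropShift d B) = tropShift (c + d) (tmul A B) := by
  ext1 i j
  have key := Finset.apply_sup_eq_sup_comp (s := (Finset.univ : Finset ι))
    (f := fun k => A i k + B k j) (fun x : TT => x + ((c + d : ℝ) : TT))
    (fun x y => (max_add_add_right x y _).symm) (WithBot.bot_add _)
  refine Eq.trans ?_ key.symm
  refine Finset.sup_congr rfl fun k _ => ?_
  simp only [tropShift, Function.comp_apply, WithBot.coe_add]
  exact add_add_add_comm _ _ _ _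

theorem foldl_tmul_tropShift {ι σ : Type} [Fintype ι] (a : σ → Matrix ι ι TT) (c : σ → ℝ)
    (w : List σ) (M : Matrix ι ι TT) (d : ℝ) :
    w.foldl (fun A s => tmul A (tropShift (c s) (a s))) (tropShift d M) =
      tropShift (d + (w.map c).sum) (w.foldl (fun A s => tmul A (a s)) M) := by
  induction w generalizing M d with
  | nil => simp
  | cons s w ih =>
    rw [List.foldl_cons, tmul_tropShift, ih, List.map_cons, List.sum_cons, List.foldl_cons,
      add_assoc]

theorem evalWord_tropShift {ι σ : Type} [Fintype ι] (a : σ → Matrix ι ι TT) (c : σ → ℝ)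
    (w : List σ) :
    evalWord (fun s => tropShift (c s) (a s)) w = tropShift (w.map c).sum (evalWord a w) := by
  cases w with
  | nil => rfl
  | cons s w => exact foldl_tmul_tropShift a c w (a s) (c s)

/-- (Matrices of size `(n+1) × (n+1)`, so that the bottom-right entry exists.)
Let `u, v ∈ Σ⁺` have the same content. If every semigroup homomorphism
`φ : Σ⁺ → UT_{n+1}(𝔽𝕋)` with `φ(s)` having bottom-right entry `0` for all letters `s`
satisfies `φ(u) = φ(v)`, then the identity `u = v` holds in `UT_{n+1}(𝕋)`. -/
theorem stmt_4 (n : ℕ) (σ : Type) [Fintype σ] [DecidableEq σ]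
    (u v : List σ) (hu : u ≠ []) (hv : v ≠ [])
    (hcontent : ∀ s : σ, u.count s = v.count s)
    (h : ∀ a : σ → Matrix (Fin (n + 1)) (Fin (n + 1)) TT,
      (∀ s, IsUT (a s)) → (∀ s i j, i ≤ j → a s i j ≠ ⊥) →
      (∀ s, a s (Fin.last n) (Fin.last n) = 0) →
      evalWord a u = evalWord a v) :
    ∀ a : σ → Matrix (Fin (n + 1)) (Fin (n + 1)) TT,
      (∀ s, IsUT (a s)) → evalWord a u = evalWord a v := by
  have hfin : ∀ a : σ → Matrix (Fin (n + 1)) (Fin (n + 1)) TT,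
      (∀ s, IsUT (a s)) → (∀ s i j, i ≤ j → a s i j ≠ ⊥) → evalWord a u = evalWord a v := by
    intro a hUT hne
    let d : σ → ℝ := fun s => (a s (Fin.last n) (Fin.last n)).unbot (hne s _ _ le_rfl)
    have hd : ∀ s, a s (Fin.last n) (Fin.last n) = (d s : TT) := fun s =>
      (WithBot.coe_unbot _ _).symm
    have key := h (fun s => tropShift (-d s) (a s))
      (fun s i j hij => by simp [tropShift, hUT s i j hij])
      (fun s i j hij => WithBot.add_ne_bot.2 ⟨hne s i j hij, WithBot.coe_ne_bot⟩)
      (fun s => by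
        rw [tropShift, hd, ← WithBot.coe_add, add_neg_cancel, WithBot.coe_zero])
    rw [evalWord_tropShift a fun s => -d s, evalWord_tropShift a fun s => -d s,
      ((List.perm_iff_count.2 hcontent).map _).sum_eq] at key
    exact tropShift_injective _ key
  intro a hUT
  let b : ℝ → σ → Matrix (Fin (n + 1)) (Fin (n + 1)) TT := fun t s i j =>
    if j < i then ⊥ else max (a s i j) ((-t : ℝ) : TT)
  have hb : ∀ s i j, TropApprox (fun t => b t s i j) (a s i j) := by
    refine fun s i j => ⟨0, fun t _ => ?_⟩
    by_cases hij : j < i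
    · simp [b, hij, hUT s i j hij]
    · simp [b, hij]
  have heq : ∀ t, evalWord (b t) u = evalWord (b t) v := by
    refine fun t => hfin (b t) (fun s i j hij => if_pos hij) fun s i j hij => ?_
    simp [b, hij.not_gt]
  ext1 i j
  have hu' := TropApprox.evalWord hb u i j
  have hv' := TropApprox.evalWord hb v i j
  simp only [heq] at hu'
  exact le_antisymm (hu'.le hv') (hv'.le hu')
end

section
/- Let φ : Σ⁺ → UT_2(𝕋) be a semigroup homomorphism such that for each s ∈ Σ, φ(s)_{1,1} = x_s ∈ ℝ, φ(s)_{1,2} = x'_s ∈ 𝕋 and φ(s)_{2,2} = 0. Then for every word w ∈ Σ⁺, φ(w)_{1,2} = max_{s ∈ Σ} (x'_s + f_s^w(x)), where x = (x_s)_{s∈Σ}. -/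
/-- The tropical polynomial function `f_t^w` associated to a word `w` and letter `t`:
`f_t^w(x) = max` over (1-based) positions `i` of `w` carrying the letter `t` of
`∑_{s ∈ Σ} λ_s^w(i-1) ⬝ x_s`, where `λ_s^w(i-1)` counts occurrences of `s` among the first
`i-1` letters of `w`; the maximum over the empty set is `-∞`. -/
def fpoly {σ : Type} [Fintype σ] [DecidableEq σ] (w : List σ) (t : σ) (x : σ → ℝ) : TT :=
  (Finset.univ.filter (fun i : Fin w.length => w.get i = t)).sup
    (fun i => (((∑ s : σ, ((w.take i.val).count s : ℝ) * x s) : ℝ) : TT))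

theorem tmul_fin_two (A B : Matrix (Fin 2) (Fin 2) TT) (i j : Fin 2) :
    tmul A B i j = (A i 0 + B 0 j) ⊔ (A i 1 + B 1 j) := by
  simp [tmul, Fin.univ_succ]

theorem evalWord_singleton {ι σ : Type} [Fintype ι] (a : σ → Matrix ι ι TT) (s : σ) :
    evalWord a [s] = a s := rfl

theorem evalWord_append_singleton {ι σ : Type} [Fintype ι] (a : σ → Matrix ι ι TT)
    {w : List σ} (hw : w ≠ []) (s : σ) :
    evalWord a (w ++ [s]) = tmul (evalWord a w) (a s) := by
  cases w with
  | nil => exact absurd rfl hw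
  | cons h t => simp [evalWord]

section

variable {σ : Type} [Fintype σ] [DecidableEq σ]

/-- The total weight `∑ s, |w|_s * x s` of a word. -/
def wordWeight (x : σ → ℝ) (w : List σ) : ℝ :=
  ∑ s : σ, (w.count s : ℝ) * x s

theorem wordWeight_nil (x : σ → ℝ) : wordWeight x [] = 0 := by
  simp [wordWeight]

theorem wordWeight_append_singleton (x : σ → ℝ) (w : List σ) (s : σ) :
    wordWeight x (w ++ [s]) = wordWeight x w + x s := by
  simp [wordWeight, List.count_append, List.count_singleton, add_mul, Finset.sum_add_distrib]

theorem fpoly_le_iff (w : List σ) (t : σ) (x : σ → ℝ) (b : TT) :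
    fpoly w t x ≤ b ↔
      ∀ (i : ℕ) (h : i < w.length), w[i] = t → (wordWeight x (w.take i) : TT) ≤ b := by
  simp [fpoly, wordWeight, Finset.sup_le_iff, Fin.forall_iff]

theorem fpoly_nil (t : σ) (x : σ → ℝ) : fpoly [] t x = ⊥ := by
  rw [← le_bot_iff, fpoly_le_iff]
  simp

theorem fpoly_append_singleton (w : List σ) (s t : σ) (x : σ → ℝ) :
    fpoly (w ++ [s]) t x = fpoly w t x ⊔ if t = s then (wordWeight x w : TT) else ⊥ := by
  refine eq_of_forall_ge_iff fun b => ?_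
  rw [sup_le_iff, fpoly_le_iff, fpoly_le_iff]
  constructor
  · refine fun H => ⟨fun i h hi => ?_, ?_⟩
    · have := H i (by simp; omega) (by rwa [List.getElem_append_left h])
      rwa [List.take_append_of_le_length h.le] at this
    · split_ifs with hts
      · simpa using H w.length (by simp) (by simp [hts])
      · exact bot_le
  · rintro ⟨H, hs⟩ i h hi
    rcases Nat.lt_or_ge i w.length with hlt | hge
    · rw [List.take_append_of_le_length hlt.le]
      exact H i hlt (by rwa [List.getElem_append_left hlt] at hi)
    · obtain rfl : i = w.length := by simp at h; omega
      have hts : t = s := by simpa using hi.symm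
      simpa [hts] using hs

theorem sup_add_fpoly_append_singleton (x : σ → ℝ) (x' : σ → TT) (w : List σ) (s : σ) :
    (Finset.univ.sup fun t : σ => x' t + fpoly (w ++ [s]) t x) =
      (Finset.univ.sup fun t : σ => x' t + fpoly w t x) ⊔ (x' s + wordWeight x w) := by
  simp only [fpoly_append_singleton, add_max]
  refine le_antisymm (Finset.sup_le fun t ht => max_le ?_ ?_)
    (sup_le (Finset.sup_mono_fun fun t _ => le_max_left _ _) ?_)
  · exact le_sup_of_le_left (Finset.le_sup (f := fun t : σ => x' t + fpoly w t x) ht)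
  · split_ifs with h
    · simp [h]
    · simp
  · refine le_trans ?_ (Finset.le_sup (Finset.mem_univ s))
    simp

theorem evalWord_entries (x : σ → ℝ) (x' : σ → TT) (w : List σ) (hw : w ≠ []) :
    evalWord (fun s => !![((x s : ℝ) : TT), x' s; ⊥, 0]) w 0 0 = wordWeight x w ∧
    evalWord (fun s => !![((x s : ℝ) : TT), x' s; ⊥, 0]) w 0 1
      = Finset.univ.sup (fun s : σ => x' s + fpoly w s x) := by
  induction w using List.reverseRecOn with
  | nil => exact absurd rfl hw
  | append_singleton w s ih =>
    rw [sup_add_fpoly_append_singleton, wordWeight_append_singleton]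
    rcases eq_or_ne w [] with rfl | hne
    · simp [evalWord_singleton, wordWeight_nil, fpoly_nil]
    · obtain ⟨h₀, h₁⟩ := ih hne
      rw [evalWord_append_singleton _ hne, tmul_fin_two, tmul_fin_two, h₀, h₁]
      refine ⟨by simp, ?_⟩
      simp [sup_comm, add_comm]

end

/-- If `φ : Σ⁺ → UT_2(𝕋)` is the homomorphism sending the letter `s` to the
matrix with rows `(x_s, x'_s)` and `(-∞, 0)`, where `x_s ∈ ℝ` and `x'_s ∈ 𝕋`, then for every
word `w ∈ Σ⁺`, the `(1,2)` entry of `φ(w)` is `max_{s ∈ Σ} (x'_s + f_s^w(x))`. -/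
theorem stmt_5 (σ : Type) [Fintype σ] [DecidableEq σ]
    (x : σ → ℝ) (x' : σ → TT) (w : List σ) (hw : w ≠ []) :
    evalWord (fun s => !![((x s : ℝ) : TT), x' s; ⊥, 0]) w 0 1
      = Finset.univ.sup (fun s : σ => x' s + fpoly w s x) := by
  exact (evalWord_entries x x' w hw).2
end
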